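/- There is a universal constant c > 0 such that for every weakly observable directed graph G on N vertices there exists T₀ (depending on G) with R*_G(T) ≤ c·N^{1/3}·T^{2/3} for every T ≥ T₀. -/

import Mathlib

open scoped BigOperators

/-- A policy maps the chronological history of (arm, feedback) pairs to a
probability distribution over arms.  The feedback after playing arm `a` is
recorded as a function `V → Option ℝ`, giving the observed loss on the
out-neighbors of `a` and `none` elsewhere. -/
def Policy (V : Type) : Type :=
  List (V × (V → Option ℝ)) → PMF V

/-- The feedback revealed when arm `a` is played against the loss vector `ℓ`:
exactly the values `ℓ j` for out-neighbors `j` of `a`. -/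
def feedbackOf {V : Type} (E : V → V → Bool) (ℓ : V → ℝ) (a : V) : V → Option ℝ :=
  fun j => if E a j then some (ℓ j) else none

/-- The chronological history produced by playing the arm sequence `as`
against the loss sequence `ℓ`. -/
def hist {V : Type} (E : V → V → Bool) (ℓ : ℕ → V → ℝ) (as : List V) :
    List (V × (V → Option ℝ)) :=
  (List.range as.length).zipWith (fun t a => (a, feedbackOf E (ℓ t) a)) as

/-- Probability that the policy `π` plays exactly the arm sequence `as`
during the first `T` rounds. -/
noncomputable def seqProb {V : Type} [Fintype V] (π : Policy V) (E : V → V → Bool)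
    (ℓ : ℕ → V → ℝ) (T : ℕ) (as : Fin T → V) : ℝ :=
  ∏ t : Fin T, (π (hist E ℓ ((List.ofFn as).take t.val)) (as t)).toReal

/-- Expected cumulative loss of the policy `π` over `T` rounds. -/
noncomputable def expectedLoss {V : Type} [Fintype V] (π : Policy V) (E : V → V → Bool)
    (ℓ : ℕ → V → ℝ) (T : ℕ) : ℝ :=
  ∑ as : Fin T → V, seqProb π E ℓ T as * ∑ t : Fin T, ℓ t.val (as t)

/-- Regret of the policy `π` with respect to the fixed arm `a`. -/
noncomputable def regretTo {V : Type} [Fintype V] (π : Policy V) (E : V → V → Bool)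
    (ℓ : ℕ → V → ℝ) (T : ℕ) (a : V) : ℝ :=
  expectedLoss π E ℓ T - ∑ t : Fin T, ℓ t.val a

/-- Regret of the policy `π` with respect to the best fixed arm. -/
noncomputable def regret {V : Type} [Fintype V] (π : Policy V) (E : V → V → Bool)
    (ℓ : ℕ → V → ℝ) (T : ℕ) : ℝ :=
  expectedLoss π E ℓ T - ⨅ a : V, ∑ t : Fin T, ℓ t.val a

/-- A loss sequence taking values in `[0,1]`. -/
def ValidLoss {V : Type} (ℓ : ℕ → V → ℝ) : Prop :=
  ∀ t v, 0 ≤ ℓ t v ∧ ℓ t v ≤ 1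

/-- The mini-max regret of the feedback graph `E` on `V` at horizon `T`. -/
noncomputable def minimaxRegret (V : Type) [Fintype V] (E : V → V → Bool) (T : ℕ) : ℝ :=
  ⨅ π : Policy V, ⨆ ℓ : {ℓ : ℕ → V → ℝ // ValidLoss ℓ}, regret π E ℓ.1 T

/-- A vertex is observable if it has an in-neighbor. -/
def ObservableVertex {V : Type} (E : V → V → Bool) (v : V) : Prop :=
  ∃ u, E u v

/-- A vertex is strongly observable if it has a self-loop or is observed by
all other vertices. -/
def StronglyObservableVertex {V : Type} (E : V → V → Bool) (v : V) : Prop :=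
  E v v ∨ ∀ u, u ≠ v → E u v

/-- A graph is observable if every vertex is observable. -/
def Observable {V : Type} (E : V → V → Bool) : Prop :=
  ∀ v, ObservableVertex E v

/-- A graph is strongly observable if every vertex is strongly observable. -/
def StronglyObservable {V : Type} (E : V → V → Bool) : Prop :=
  ∀ v, StronglyObservableVertex E v

/-- A graph is weakly observable if it is observable but not strongly
observable. -/
def WeaklyObservable {V : Type} (E : V → V → Bool) : Prop :=
  Observable E ∧ ¬ StronglyObservable E

/-- The regularised linear loss `⟨L, x⟩ - (2 / η) ∑ √x`, written in terms of `s = √x`. -/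
noncomputable def tsallisPotential {V : Type} [Fintype V] (η : ℝ) (L s : V → ℝ) : ℝ :=
  ∑ v, (L v * s v ^ 2 - 2 / η * s v)

/-- The first-order optimality conditions for minimising `tsallisPotential η L` over the
vectors `s` whose squares form a probability distribution. -/
def IsTsallisMinimizer {V : Type} [Fintype V] (η : ℝ) (L s : V → ℝ) : Prop :=
  (∀ v, 0 < s v) ∧ ∑ v, s v ^ 2 = 1 ∧ ∃ z : ℝ, ∀ v, L v = z + 1 / (η * s v)

theorem exists_isTsallisMinimizer {V : Type} [Fintype V] [Nonempty V] {η : ℝ} (hη : 0 < η)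
    (L : V → ℝ) : ∃ s, IsTsallisMinimizer η L s := by
  obtain ⟨m, hm⟩ := Finite.exists_min L
  set N : ℝ := (Fintype.card V : ℝ) with hN
  have hN1 : 1 ≤ N := by
    rw [hN]; exact_mod_cast Fintype.card_pos
  have hsq : 1 ≤ √N := Real.one_le_sqrt.2 hN1
  have hle : L m - √N / η ≤ L m - 1 / η := by gcongr
  have hpos : ∀ z ≤ L m - 1 / η, ∀ v, 1 ≤ η * (L v - z) := by
    intro z hz v
    have h1 : 1 / η ≤ L v - z := by linarith [hm v]
    calc 1 = η * (1 / η) := by field_simp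
      _ ≤ _ := by gcongr
  have hcont : ContinuousOn (fun z => ∑ v, (1 / (η * (L v - z))) ^ 2)
      (Set.Icc (L m - √N / η) (L m - 1 / η)) := by
    refine continuousOn_finsetSum _ fun v _ => ?_
    refine ContinuousOn.pow (ContinuousOn.div continuousOn_const (by fun_prop) ?_) 2
    intro z hz
    linarith [hpos z hz.2 v]
  obtain ⟨z, hz, hsum⟩ := intermediate_value_Icc hle hcont (show (1 : ℝ) ∈ _ by
    constructor
    · have hb : ∀ v ∈ Finset.univ, (1 / (η * (L v - (L m - √N / η)))) ^ 2 ≤ 1 / N := by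
        intro v _
        have h1 : √N ≤ η * (L v - (L m - √N / η)) := by
          have : 0 ≤ η * (L v - L m) := mul_nonneg hη.le (by linarith [hm v])
          have h2 : η * (√N / η) = √N := by field_simp
          nlinarith
        have h3 : 0 < √N := by linarith
        have h4 : 0 < η * (L v - (L m - √N / η)) := h3.trans_le h1
        calc (1 / (η * (L v - (L m - √N / η)))) ^ 2 ≤ (1 / √N) ^ 2 := by gcongr
          _ = 1 / N := by rw [div_pow, Real.sq_sqrt (by linarith), one_pow]
      refine (Finset.sum_le_sum hb).trans ?_
      rw [Finset.sum_const, Finset.card_univ, nsmul_eq_mul, ← hN]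
      exact (mul_one_div_cancel (by linarith)).le
    · refine le_trans (le_of_eq ?_) (Finset.single_le_sum
        (f := fun v => (1 / (η * (L v - (L m - 1 / η)))) ^ 2)
        (fun v _ => sq_nonneg _) (Finset.mem_univ m))
      simp [hη.ne'])
  refine ⟨fun v => 1 / (η * (L v - z)), fun v => ?_, hsum, z, fun v => ?_⟩
  · have := hpos z hz.2 v
    positivity
  · have := hpos z hz.2 v
    have h0 : L v - z ≠ 0 := by
      rintro h
      rw [h] at this
      linarith
    field_simp
    ring

theorem IsTsallisMinimizer.potential_eq {V : Type} [Fintype V] {η : ℝ} (hη : 0 < η)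
    {L s r : V → ℝ} (hs : IsTsallisMinimizer η L s) (hr : ∑ v, r v ^ 2 = 1) :
    tsallisPotential η L r =
      tsallisPotential η L s + ∑ v, (r v - s v) ^ 2 / (η * s v) := by
  obtain ⟨hpos, hsum, z, hz⟩ := hs
  have key : ∀ v, L v * r v ^ 2 - 2 / η * r v =
      L v * s v ^ 2 - 2 / η * s v + (r v - s v) ^ 2 / (η * s v) +
        z * (r v ^ 2 - s v ^ 2) := by
    intro v
    have := (hpos v).ne'
    rw [hz v]
    field_simp
    ring
  unfold tsallisPotential
  rw [Finset.sum_congr rfl fun v _ => key v, Finset.sum_add_distrib, Finset.sum_add_distrib,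
    ← Finset.mul_sum, Finset.sum_sub_distrib (fun v => r v ^ 2), hr, hsum]
  ring

/-- Stability of the potential under a nonnegative loss increment. -/
theorem IsTsallisMinimizer.le_potential_add {V : Type} [Fintype V] {η : ℝ} (hη : 0 < η)
    {L s r d : V → ℝ} (hs : IsTsallisMinimizer η L s) (hr : ∑ v, r v ^ 2 = 1)
    (hd : ∀ v, 0 ≤ d v) :
    tsallisPotential η L s + ∑ v, d v * s v ^ 2 - η * ∑ v, s v ^ 3 * d v ^ 2 ≤
      tsallisPotential η (fun v => L v + d v) r := by
  have h1 : tsallisPotential η (fun v => L v + d v) r =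
      tsallisPotential η L r + ∑ v, d v * r v ^ 2 := by
    unfold tsallisPotential
    rw [← Finset.sum_add_distrib]
    exact Finset.sum_congr rfl fun v _ => by ring
  have h2 : ∑ v, (d v * s v ^ 2 - η * (s v ^ 3 * d v ^ 2)) ≤
      ∑ v, ((r v - s v) ^ 2 / (η * s v) + d v * r v ^ 2) := by
    refine Finset.sum_le_sum fun v _ => ?_
    have hsv := hs.1 v
    have h3 : (r v - s v) ^ 2 / (η * s v) + d v * r v ^ 2
        - (d v * s v ^ 2 - η * (s v ^ 3 * d v ^ 2)) =
        (r v - s v + η * s v ^ 2 * d v) ^ 2 / (η * s v) + d v * (r v - s v) ^ 2 := by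
      field_simp
      ring
    have h4 : 0 ≤ (r v - s v + η * s v ^ 2 * d v) ^ 2 / (η * s v) + d v * (r v - s v) ^ 2 := by
      have := hd v
      positivity
    linarith
  rw [Finset.sum_sub_distrib, Finset.sum_add_distrib, ← Finset.mul_sum] at h2
  rw [h1, hs.potential_eq hη hr]
  linarith

theorem IsTsallisMinimizer.potential_le {V : Type} [Fintype V] {η : ℝ} (hη : 0 < η)
    {L s : V → ℝ} (hs : IsTsallisMinimizer η L s) (a : V) :
    tsallisPotential η L s ≤ L a := by
  classical
  have h1 : tsallisPotential η L (Pi.single a 1) = L a - 2 / η := by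
    unfold tsallisPotential
    rw [Finset.sum_eq_single a] <;> simp +contextual
  have h2 := hs.potential_eq hη (r := Pi.single a 1) (by
    rw [Finset.sum_eq_single a] <;> simp +contextual)
  have h3 : 0 ≤ ∑ v, ((Pi.single a 1 : V → ℝ) v - s v) ^ 2 / (η * s v) :=
    Finset.sum_nonneg fun v _ => by
      have := hs.1 v
      positivity
  have h4 : 0 < 2 / η := by positivity
  linarith

theorem sum_le_sqrt_card_of_sum_sq_eq_one {V : Type} [Fintype V] {s : V → ℝ}
    (hs : ∑ v, s v ^ 2 = 1) : ∑ v, s v ≤ √(Fintype.card V) := by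
  refine Real.le_sqrt_of_sq_le ?_
  have := sq_sum_le_card_mul_sum_sq (s := Finset.univ) (f := s)
  rwa [hs, mul_one, Finset.card_univ] at this

theorem neg_le_potential_zero {V : Type} [Fintype V] {η : ℝ} (hη : 0 < η)
    {s : V → ℝ} (hs : ∑ v, s v ^ 2 = 1) :
    -(2 / η * √(Fintype.card V)) ≤ tsallisPotential η 0 s := by
  have h : tsallisPotential η 0 s = -(2 / η * ∑ v, s v) := by
    simp [tsallisPotential, Finset.mul_sum]
  rw [h]
  have := sum_le_sqrt_card_of_sum_sq_eq_one hs
  gcongr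

theorem hist_concat {V : Type} (E : V → V → Bool) (ℓ : ℕ → V → ℝ) (as : List V) (a : V) :
    hist E ℓ (as ++ [a]) = hist E ℓ as ++ [(a, feedbackOf E (ℓ as.length) a)] := by
  unfold hist
  rw [List.length_append, List.length_singleton, List.range_succ,
    List.zipWith_append (by simp)]
  rfl

theorem ofFn_snoc {V : Type} {T : ℕ} (as : Fin T → V) (a : V) :
    List.ofFn (Fin.snoc as a : Fin (T + 1) → V) = List.ofFn as ++ [a] := by
  rw [List.ofFn_succ_last]
  simp

theorem seqProb_snoc {V : Type} [Fintype V] (π : Policy V) (E : V → V → Bool)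
    (ℓ : ℕ → V → ℝ) (T : ℕ) (as : Fin T → V) (a : V) :
    seqProb π E ℓ (T + 1) (Fin.snoc as a) =
      seqProb π E ℓ T as * (π (hist E ℓ (List.ofFn as)) a).toReal := by
  unfold seqProb
  rw [Fin.prod_univ_castSucc, ofFn_snoc]
  congr 1
  · refine Finset.prod_congr rfl fun t _ => ?_
    rw [Fin.snoc_castSucc, Fin.val_castSucc, List.take_append_of_le_length (by simp [t.2.le])]
  · rw [Fin.snoc_last, Fin.val_last, List.take_append_of_le_length (by simp),
      List.take_of_length_le (by simp)]

theorem sum_seqProb_succ {V : Type} [Fintype V] (π : Policy V) (E : V → V → Bool)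
    (ℓ : ℕ → V → ℝ) (T : ℕ) (f : (Fin (T + 1) → V) → ℝ) :
    ∑ as, seqProb π E ℓ (T + 1) as * f as =
      ∑ as, seqProb π E ℓ T as *
        ∑ a, (π (hist E ℓ (List.ofFn as)) a).toReal * f (Fin.snoc as a) := by
  rw [← (Fin.snocEquiv (fun _ => V)).sum_comp, Fintype.sum_prod_type_right]
  refine Finset.sum_congr rfl fun as _ => ?_
  rw [Finset.mul_sum]
  refine Finset.sum_congr rfl fun a _ => ?_
  rw [← mul_assoc, ← seqProb_snoc]
  rfl

theorem seqProb_nonneg {V : Type} [Fintype V] (π : Policy V) (E : V → V → Bool)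
    (ℓ : ℕ → V → ℝ) (T : ℕ) (as : Fin T → V) : 0 ≤ seqProb π E ℓ T as :=
  Finset.prod_nonneg fun _ _ => ENNReal.toReal_nonneg

theorem PMF.sum_toReal {V : Type} [Fintype V] (p : PMF V) : ∑ a, (p a).toReal = 1 := by
  have h := p.tsum_coe
  rw [tsum_fintype] at h
  rw [← ENNReal.toReal_sum fun a _ => p.apply_ne_top a, h, ENNReal.toReal_one]

theorem sum_seqProb {V : Type} [Fintype V] (π : Policy V) (E : V → V → Bool)
    (ℓ : ℕ → V → ℝ) (T : ℕ) : ∑ as, seqProb π E ℓ T as = 1 := by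
  induction T with
  | zero => simp [seqProb]
  | succ T ih =>
    have := sum_seqProb_succ π E ℓ T fun _ => 1
    simpa only [mul_one, PMF.sum_toReal, ih] using this

/-- Probability that vertex `v` is observed when the arm is drawn with weights `p`. -/
noncomputable def observeProb {V : Type} [Fintype V] (E : V → V → Bool) (p : V → ℝ) (v : V) : ℝ :=
  ∑ u, if E u v then p u else 0

/-- The importance-weighted loss estimate built from the feedback `F`. -/
noncomputable def lossEstimate {V : Type} [Fintype V] (E : V → V → Bool) (p : V → ℝ)
    (F : V → Option ℝ) (v : V) : ℝ :=
  (F v).getD 0 / observeProb E p v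

/-- The cumulative loss estimates after a history, when the sampling weights are the function `w`
of the current cumulative estimates. -/
noncomputable def cumEstimate {V : Type} [Fintype V] (E : V → V → Bool)
    (w : (V → ℝ) → V → ℝ) (h : List (V × (V → Option ℝ))) : V → ℝ :=
  h.foldl (fun L x v => L v + lossEstimate E (w L) x.2 v) 0

theorem cumEstimate_concat {V : Type} [Fintype V] (E : V → V → Bool)
    (w : (V → ℝ) → V → ℝ) (h : List (V × (V → Option ℝ))) (x : V × (V → Option ℝ)) :
    cumEstimate E w (h ++ [x]) = fun v => cumEstimate E w h v +
      lossEstimate E (w (cumEstimate E w h)) x.2 v := by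
  simp [cumEstimate]

theorem lossEstimate_feedbackOf {V : Type} [Fintype V] (E : V → V → Bool) (p : V → ℝ)
    (ℓ : V → ℝ) (a v : V) :
    lossEstimate E p (feedbackOf E ℓ a) v =
      (if E a v then 1 else 0) * (ℓ v / observeProb E p v) := by
  unfold lossEstimate feedbackOf
  split <;> simp

theorem sum_mul_lossEstimate {V : Type} [Fintype V] (E : V → V → Bool) (p : V → ℝ)
    (ℓ : V → ℝ) (v : V) (hv : observeProb E p v ≠ 0) :
    ∑ a, p a * lossEstimate E p (feedbackOf E ℓ a) v = ℓ v := by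
  simp_rw [lossEstimate_feedbackOf, ← mul_assoc]
  rw [← Finset.sum_mul]
  simp_rw [mul_ite, mul_one, mul_zero]
  exact mul_div_cancel₀ _ hv

theorem sum_mul_lossEstimate_sq {V : Type} [Fintype V] (E : V → V → Bool) (p : V → ℝ)
    (ℓ : V → ℝ) (v : V) (hv : observeProb E p v ≠ 0) :
    ∑ a, p a * lossEstimate E p (feedbackOf E ℓ a) v ^ 2 = ℓ v ^ 2 / observeProb E p v := by
  simp_rw [lossEstimate_feedbackOf, mul_pow, ← mul_assoc]
  rw [← Finset.sum_mul]
  simp_rw [ite_pow, one_pow, zero_pow two_ne_zero, mul_ite, mul_one, mul_zero]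
  change observeProb E p v * _ = _
  field_simp

open Classical in
/-- Sampling weights that follow `s ^ 2` with probability `1 - γ`, and with probability `γ` play
`obs v` for `v` drawn from `s ^ 2`. -/
noncomputable def exploreWeights {V : Type} [Fintype V] (γ : ℝ) (obs : V → V) (s : V → ℝ)
    (u : V) : ℝ :=
  (1 - γ) * s u ^ 2 + γ * ∑ v, if obs v = u then s v ^ 2 else 0

section ExploreWeights

variable {V : Type} [Fintype V] {γ : ℝ} {obs : V → V} {s : V → ℝ}

theorem exploreWeights_nonneg (h0 : 0 ≤ γ) (h1 : γ ≤ 1) (u : V) :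
    0 ≤ exploreWeights γ obs s u := by
  classical
  unfold exploreWeights
  have : 0 ≤ ∑ v, if obs v = u then s v ^ 2 else 0 :=
    Finset.sum_nonneg fun v _ => by positivity
  have := sub_nonneg.2 h1
  positivity

theorem sum_exploreWeights_mul (ℓ : V → ℝ) :
    ∑ u, exploreWeights γ obs s u * ℓ u =
      (1 - γ) * ∑ u, s u ^ 2 * ℓ u + γ * ∑ v, s v ^ 2 * ℓ (obs v) := by
  classical
  unfold exploreWeights
  simp_rw [add_mul, Finset.sum_add_distrib, mul_assoc, ← Finset.mul_sum, Finset.sum_mul]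
  rw [Finset.sum_comm]
  simp

theorem sum_exploreWeights (hs : ∑ v, s v ^ 2 = 1) : ∑ u, exploreWeights γ obs s u = 1 := by
  have := sum_exploreWeights_mul (γ := γ) (obs := obs) (s := s) fun _ => 1
  simp only [mul_one, hs] at this
  linarith

theorem sum_exploreWeights_mul_le (h0 : 0 ≤ γ) (hs : ∑ v, s v ^ 2 = 1) {ℓ : V → ℝ}
    (hℓ : ∀ v, 0 ≤ ℓ v ∧ ℓ v ≤ 1) :
    ∑ u, exploreWeights γ obs s u * ℓ u ≤ ∑ u, ℓ u * s u ^ 2 + γ := by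
  have h1 : ∑ v, s v ^ 2 * ℓ (obs v) ≤ 1 := by
    rw [← hs]
    exact Finset.sum_le_sum fun v _ => mul_le_of_le_one_right (sq_nonneg _) (hℓ _).2
  have h2 : 0 ≤ ∑ u, s u ^ 2 * ℓ u :=
    Finset.sum_nonneg fun v _ => mul_nonneg (sq_nonneg _) (hℓ v).1
  rw [sum_exploreWeights_mul]
  simp_rw [mul_comm (ℓ _)]
  nlinarith

theorem le_observeProb_exploreWeights {E : V → V → Bool} (h0 : 0 ≤ γ) (h1 : γ ≤ 1)
    (hobs : ∀ v, E (obs v) v) (v : V) :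
    γ * s v ^ 2 ≤ observeProb E (exploreWeights γ obs s) v := by
  classical
  have hnn := exploreWeights_nonneg (obs := obs) (s := s) h0 h1
  calc γ * s v ^ 2 ≤ γ * ∑ w, if obs w = obs v then s w ^ 2 else 0 := by
        gcongr
        refine le_trans (by simp) (Finset.single_le_sum
          (f := fun w => if obs w = obs v then s w ^ 2 else 0)
          (fun w _ => by positivity) (Finset.mem_univ v))
    _ ≤ exploreWeights γ obs s (obs v) :=
        le_add_of_nonneg_left (mul_nonneg (sub_nonneg.2 h1) (sq_nonneg _))
    _ = if E (obs v) v then exploreWeights γ obs s (obs v) else 0 := by simp [hobs v]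
    _ ≤ _ := Finset.single_le_sum
          (f := fun u => if E u v then exploreWeights γ obs s u else 0)
          (fun u _ => by split <;> simp [hnn]) (Finset.mem_univ (obs v))

/-- One-round drift of the potential under exploring play. -/
theorem sum_exploreWeights_potential_le {E : V → V → Bool} {η : ℝ} (hη : 0 < η) (h0 : 0 < γ)
    (h1 : γ ≤ 1) (hobs : ∀ v, E (obs v) v) {L ℓ : V → ℝ} (hs : IsTsallisMinimizer η L s)
    (hℓ : ∀ v, 0 ≤ ℓ v ∧ ℓ v ≤ 1) (r : V → V → ℝ) (hr : ∀ a, ∑ v, r a v ^ 2 = 1) :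
    ∑ a, exploreWeights γ obs s a * (ℓ a - tsallisPotential η (fun v => L v +
        lossEstimate E (exploreWeights γ obs s) (feedbackOf E ℓ a) v) (r a)) ≤
      -tsallisPotential η L s + (γ + η * √(Fintype.card V) / γ) := by
  set p := exploreWeights γ obs s
  have hnn : ∀ a, 0 ≤ p a := exploreWeights_nonneg h0.le h1
  have hP : ∀ v, γ * s v ^ 2 ≤ observeProb E p v :=
    le_observeProb_exploreWeights h0.le h1 hobs
  have hP0 : ∀ v, 0 < observeProb E p v := fun v =>
    lt_of_lt_of_le (mul_pos h0 (pow_pos (hs.1 v) 2)) (hP v)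
  set d : V → V → ℝ := fun a v => lossEstimate E p (feedbackOf E ℓ a) v with hd
  have hd0 : ∀ a v, 0 ≤ d a v := by
    intro a v
    simp only [hd, lossEstimate_feedbackOf]
    exact mul_nonneg (by positivity) (div_nonneg (hℓ v).1 (hP0 v).le)
  have hsum : ∑ a, p a = 1 := sum_exploreWeights hs.2.1
  have hlin : ∑ a, p a * ∑ v, d a v * s v ^ 2 = ∑ v, ℓ v * s v ^ 2 := by
    simp_rw [Finset.mul_sum]
    rw [Finset.sum_comm]
    refine Finset.sum_congr rfl fun v _ => ?_
    simp_rw [← mul_assoc]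
    rw [← Finset.sum_mul, sum_mul_lossEstimate E p ℓ v (hP0 v).ne']
  have hquad : ∑ a, p a * ∑ v, s v ^ 3 * d a v ^ 2 ≤ √(Fintype.card V) / γ := by
    simp_rw [Finset.mul_sum]
    rw [Finset.sum_comm]
    calc ∑ v, ∑ a, p a * (s v ^ 3 * d a v ^ 2)
        = ∑ v, s v ^ 3 * (ℓ v ^ 2 / observeProb E p v) := by
          refine Finset.sum_congr rfl fun v _ => ?_
          rw [← sum_mul_lossEstimate_sq E p ℓ v (hP0 v).ne', Finset.mul_sum]
          exact Finset.sum_congr rfl fun a _ => by ring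
      _ ≤ ∑ v, s v / γ := by
          refine Finset.sum_le_sum fun v _ => ?_
          have hsv := hs.1 v
          calc s v ^ 3 * (ℓ v ^ 2 / observeProb E p v) ≤ s v ^ 3 * (1 / (γ * s v ^ 2)) := by
                have := pow_le_one₀ (n := 2) (hℓ v).1 (hℓ v).2
                have := hP v
                gcongr
            _ = s v / γ := by field_simp
      _ ≤ _ := by
          rw [← Finset.sum_div]
          have := sum_le_sqrt_card_of_sum_sq_eq_one hs.2.1
          gcongr
  calc ∑ a, p a * (ℓ a - tsallisPotential η (fun v => L v + d a v) (r a))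
      ≤ ∑ a, p a * (ℓ a - (tsallisPotential η L s + ∑ v, d a v * s v ^ 2
          - η * ∑ v, s v ^ 3 * d a v ^ 2)) := by
        refine Finset.sum_le_sum fun a _ => mul_le_mul_of_nonneg_left ?_ (hnn a)
        have := hs.le_potential_add hη (hr a) (hd0 a)
        linarith
    _ = ∑ a, p a * ℓ a - (∑ a, p a) * tsallisPotential η L s
          - ∑ a, p a * ∑ v, d a v * s v ^ 2 + η * ∑ a, p a * ∑ v, s v ^ 3 * d a v ^ 2 := by
        rw [Finset.sum_mul, Finset.mul_sum, ← Finset.sum_sub_distrib, ← Finset.sum_sub_distrib,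
          ← Finset.sum_add_distrib]
        exact Finset.sum_congr rfl fun a _ => by ring
    _ ≤ _ := by
        have h3 := sum_exploreWeights_mul_le (obs := obs) h0.le hs.2.1 hℓ
        have h4 := mul_le_mul_of_nonneg_left hquad hη.le
        rw [hsum, hlin, one_mul]
        rw [mul_div_assoc]
        linarith

end ExploreWeights

/-- For an observable graph and parameters `η > 0`, `γ ∈ (0, 1]`, exploring play based on the
`1/2`-Tsallis regulariser has regret at most `γ T + 2 √N / η + η T √N / γ`. -/
theorem exists_policy_regretTo_le {V : Type} [Fintype V] [Nonempty V] {E : V → V → Bool}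
    (hE : Observable E) {η γ : ℝ} (hη : 0 < η) (h0 : 0 < γ) (h1 : γ ≤ 1) :
    ∃ π : Policy V, ∀ ℓ, ValidLoss ℓ → ∀ T a,
      regretTo π E ℓ T a ≤
        2 / η * √(Fintype.card V) + T * (γ + η * √(Fintype.card V) / γ) := by
  choose obs hobs using hE
  choose s hs using exists_isTsallisMinimizer (V := V) hη
  set w : (V → ℝ) → V → ℝ := fun L => exploreWeights γ obs (s L) with hw
  have hw0 : ∀ L u, 0 ≤ w L u := fun L => exploreWeights_nonneg h0.le h1
  have hw1 : ∀ L, ∑ u, w L u = 1 := fun L => sum_exploreWeights (hs L).2.1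
  let π : Policy V := fun h =>
    PMF.ofFintype (fun u => ENNReal.ofReal (w (cumEstimate E w h) u)) (by
      rw [← ENNReal.ofReal_sum_of_nonneg fun u _ => hw0 _ u, hw1, ENNReal.ofReal_one])
  have hπ : ∀ h u, (π h u).toReal = w (cumEstimate E w h) u := fun h u =>
    ENNReal.toReal_ofReal (hw0 _ u)
  refine ⟨π, fun ℓ hℓ T a => ?_⟩
  set K := γ + η * √(Fintype.card V) / γ with hK
  let Lhat : (T : ℕ) → (Fin T → V) → V → ℝ := fun T as =>
    cumEstimate E w (hist E ℓ (List.ofFn as))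
  let Φ : (V → ℝ) → ℝ := fun L => tsallisPotential η L (s L)
  have hsnoc : ∀ T (as : Fin T → V) u, Lhat (T + 1) (Fin.snoc as u) = fun v =>
      Lhat T as v + lossEstimate E (w (Lhat T as)) (feedbackOf E (ℓ T) u) v := by
    intro T as u
    simp only [Lhat, ofFn_snoc, hist_concat, cumEstimate_concat, List.length_ofFn]
  have hmean : ∀ T, ∑ as, seqProb π E ℓ T as * Lhat T as a = ∑ t : Fin T, ℓ t a := by
    intro T
    induction T with
    | zero => simp [Lhat, hist, cumEstimate]
    | succ T ih =>
      rw [sum_seqProb_succ, Fin.sum_univ_castSucc]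
      simp only [Fin.val_castSucc, Fin.val_last]
      rw [← ih, ← one_mul (ℓ T a), ← sum_seqProb π E ℓ T, Finset.sum_mul,
        ← Finset.sum_add_distrib]
      refine Finset.sum_congr rfl fun as _ => ?_
      rw [← mul_add]
      congr 1
      simp_rw [hπ, hsnoc, mul_add]
      rw [Finset.sum_add_distrib, ← Finset.sum_mul, hw1, one_mul]
      congr 1
      refine sum_mul_lossEstimate E _ (ℓ T) a (ne_of_gt ?_)
      exact lt_of_lt_of_le (mul_pos h0 (pow_pos ((hs _).1 a) 2))
        (le_observeProb_exploreWeights h0.le h1 hobs a)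
  have hdrift : ∀ T, ∑ as, seqProb π E ℓ T as * (∑ t : Fin T, ℓ t (as t) - Φ (Lhat T as)) ≤
      -Φ 0 + T * K := by
    intro T
    induction T with
    | zero => simp [Lhat, hist, cumEstimate, seqProb]
    | succ T ih =>
      rw [sum_seqProb_succ]
      calc _ ≤ ∑ as, seqProb π E ℓ T as *
            ((∑ t : Fin T, ℓ t (as t) - Φ (Lhat T as)) + K) := by
            refine Finset.sum_le_sum fun as _ =>
              mul_le_mul_of_nonneg_left ?_ (seqProb_nonneg ..)
            have hstep := sum_exploreWeights_potential_le hη h0 h1 hobs (hs (Lhat T as)) (hℓ T)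
              (fun u => s (Lhat (T + 1) (Fin.snoc as u))) (fun u => (hs _).2.1)
            calc _ = ∑ u, w (Lhat T as) u * ∑ t : Fin T, ℓ t (as t) +
                  ∑ u, w (Lhat T as) u * (ℓ T u - Φ (Lhat (T + 1) (Fin.snoc as u))) := by
                  rw [← Finset.sum_add_distrib]
                  refine Finset.sum_congr rfl fun u _ => ?_
                  rw [hπ, Fin.sum_univ_castSucc]
                  simp only [Fin.val_castSucc, Fin.val_last, Fin.snoc_castSucc, Fin.snoc_last,
                    Lhat]
                  ring
              _ ≤ _ := by
                  rw [← Finset.sum_mul, hw1, one_mul]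
                  simp only [hw, hsnoc, Φ, hK] at hstep ⊢
                  linarith
        _ = ∑ as, seqProb π E ℓ T as * (∑ t : Fin T, ℓ t (as t) - Φ (Lhat T as)) + K := by
            simp_rw [mul_add (seqProb _ _ _ _ _)]
            rw [Finset.sum_add_distrib, ← Finset.sum_mul, sum_seqProb, one_mul]
        _ ≤ _ := by
            push_cast
            linarith
  have hΦ : ∑ as, seqProb π E ℓ T as * Φ (Lhat T as) ≤ ∑ t : Fin T, ℓ t a := by
    rw [← hmean T]
    exact Finset.sum_le_sum fun as _ =>
      mul_le_mul_of_nonneg_left ((hs _).potential_le hη a) (seqProb_nonneg ..)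
  have hzero : -(2 / η * √(Fintype.card V)) ≤ Φ 0 := neg_le_potential_zero hη (hs 0).2.1
  have hT := hdrift T
  simp_rw [mul_sub] at hT
  rw [Finset.sum_sub_distrib] at hT
  unfold regretTo expectedLoss
  linarith

theorem minimaxRegret_le {V : Type} [Fintype V] [Nonempty V] {E : V → V → Bool} {T : ℕ} {B : ℝ}
    (π : Policy V) (h : ∀ ℓ, ValidLoss ℓ → ∀ a, regretTo π E ℓ T a ≤ B) :
    minimaxRegret V E T ≤ B := by
  have hvalid : ValidLoss (fun _ _ => 0 : ℕ → V → ℝ) := fun _ _ => ⟨le_rfl, zero_le_one⟩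
  have : Nonempty {ℓ : ℕ → V → ℝ // ValidLoss ℓ} := ⟨⟨_, hvalid⟩⟩
  have hbdd : BddBelow (Set.range fun π : Policy V =>
      ⨆ ℓ : {ℓ : ℕ → V → ℝ // ValidLoss ℓ}, regret π E ℓ.1 T) := by
    refine ⟨0, ?_⟩
    rintro _ ⟨π, rfl⟩
    by_cases hb : BddAbove (Set.range fun ℓ : {ℓ : ℕ → V → ℝ // ValidLoss ℓ} => regret π E ℓ.1 T)
    · refine le_trans (le_of_eq ?_) (le_ciSup hb ⟨_, hvalid⟩)
      simp [regret, expectedLoss]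
    · exact (Real.iSup_of_not_bddAbove hb).ge
  refine (ciInf_le hbdd π).trans (ciSup_le fun ℓ => ?_)
  obtain ⟨a, ha⟩ := exists_eq_ciInf_of_finite (f := fun a : V => ∑ t : Fin T, ℓ.1 t.val a)
  have := h ℓ.1 ℓ.2 a
  unfold regretTo at this
  unfold regret
  rwa [← ha]

/-- There is a universal constant `c > 0` such that every weakly
observable graph on `N` vertices has mini-max regret at most `c · N^{1/3} · T^{2/3}`
for all sufficiently large `T`. -/
theorem weakly_observable_universal_upper_bound :
    ∃ c : ℝ, 0 < c ∧
      ∀ (V : Type) [Fintype V] (E : V → V → Bool), WeaklyObservable E →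
        ∃ T₀ : ℕ, ∀ T : ℕ, T₀ ≤ T →
          minimaxRegret V E T ≤
            c * (Fintype.card V : ℝ) ^ ((1 : ℝ) / 3) * (T : ℝ) ^ ((2 : ℝ) / 3) := by
  refine ⟨4, by norm_num, fun V _ E hE => ⟨Fintype.card V, fun T hT => ?_⟩⟩
  have : Nonempty V := by
    by_contra hV
    exact hE.2 fun v => (hV ⟨v⟩).elim
  have hcard : 0 < Fintype.card V := Fintype.card_pos
  have hN : (0 : ℝ) < Fintype.card V := by exact_mod_cast hcard
  have hT0 : (0 : ℝ) < T := by exact_mod_cast hcard.trans_le hT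
  set x : ℝ := (Fintype.card V : ℝ) ^ ((1 : ℝ) / 6) with hx
  set y : ℝ := (T : ℝ) ^ ((1 : ℝ) / 6) with hy
  have hx0 : 0 < x := Real.rpow_pos_of_pos hN _
  have hy0 : 0 < y := Real.rpow_pos_of_pos hT0 _
  have hxy : x ≤ y := Real.rpow_le_rpow hN.le (by exact_mod_cast hT) (by norm_num)
  have hsqrt : √(Fintype.card V : ℝ) = x ^ 3 := by
    rw [Real.sqrt_eq_rpow, hx, ← Real.rpow_natCast, ← Real.rpow_mul hN.le]
    norm_num
  have hx2 : (Fintype.card V : ℝ) ^ ((1 : ℝ) / 3) = x ^ 2 := by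
    rw [hx, ← Real.rpow_natCast, ← Real.rpow_mul hN.le]
    norm_num
  have hy4 : (T : ℝ) ^ ((2 : ℝ) / 3) = y ^ 4 := by
    rw [hy, ← Real.rpow_natCast, ← Real.rpow_mul hT0.le]
    norm_num
  have hy6 : (T : ℝ) = y ^ 6 := by
    rw [hy, ← Real.rpow_natCast, ← Real.rpow_mul hT0.le]
    norm_num
  obtain ⟨π, hπ⟩ := exists_policy_regretTo_le hE.1 (η := x / y ^ 4) (γ := x ^ 2 / y ^ 2)
    (by positivity) (by positivity) (by
      rw [div_le_one (by positivity)]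
      gcongr)
  refine minimaxRegret_le π fun ℓ hℓ a => (hπ ℓ hℓ T a).trans (le_of_eq ?_)
  rw [hsqrt, hx2, hy4, hy6]
  field_simp
  ring
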